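/- For every grid data f = (f_0, …, f_N) with f_0 = f_N = 0, the functional I(u) = ∫_0^1 |u″(x)|² dx attains a minimum over the admissible class A of interpolating functions, and the minimizer is unique: there exists exactly one s ∈ A with I(s) ≤ I(u) for all u ∈ A. -/

import Mathlib

open MeasureTheory Set

/-- The bending energy functional `I(u) = ∫₀¹ |u''(x)|² dx`, expressed through a
representative `g` of the (weak) second derivative. -/
noncomputable def energy (g : ℝ → ℝ) : ℝ := ∫ x in (0:ℝ)..1, (g x) ^ 2

/-- The admissible class `A`: pairs `(u, g)` where `u : [0,1] → ℝ` is continuously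
differentiable, its derivative is absolutely continuous with (weak) second derivative
`g ∈ L²(0,1)`, `u` satisfies the clamped boundary conditions
`u(0) = u'(0) = u(1) = u'(1) = 0`, and `u` interpolates the data `f` at the nodes
`x_j = j/N`. -/
def InAdm (N : ℕ) (f : ℕ → ℝ) (u g : ℝ → ℝ) : Prop :=
  ContDiffOn ℝ 1 u (Set.Icc 0 1) ∧
  IntervalIntegrable g MeasureTheory.volume 0 1 ∧
  IntervalIntegrable (fun x => (g x) ^ 2) MeasureTheory.volume 0 1 ∧
  (∀ x ∈ Set.Icc (0:ℝ) 1,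
    derivWithin u (Set.Icc 0 1) x
      = derivWithin u (Set.Icc 0 1) 0 + ∫ t in (0:ℝ)..x, g t) ∧
  u 0 = 0 ∧ u 1 = 0 ∧
  derivWithin u (Set.Icc 0 1) 0 = 0 ∧ derivWithin u (Set.Icc 0 1) 1 = 0 ∧
  ∀ j : ℕ, j ≤ N → u ((j : ℝ) / N) = f j

/-- The measure underlying `L²(0,1)`. -/
noncomputable abbrev unitMeasure : Measure ℝ := volume.restrict (Ioc (0:ℝ) 1)

/-- The twofold primitive of `g` with zero initial data at `0`. -/
noncomputable def doublePrimitive (g : ℝ → ℝ) (x : ℝ) : ℝ :=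
  ∫ y in (0:ℝ)..x, ∫ t in (0:ℝ)..y, g t

lemma primitive_congr {g g' : ℝ → ℝ} (h : g =ᵐ[unitMeasure] g') {y : ℝ} (hy : y ∈ Icc (0:ℝ) 1) :
    ∫ t in (0:ℝ)..y, g t = ∫ t in (0:ℝ)..y, g' t := by
  refine intervalIntegral.integral_congr_ae_restrict ?_
  rw [uIoc_of_le hy.1]
  exact ae_restrict_of_ae_restrict_of_subset (Ioc_subset_Ioc_right hy.2) h

lemma doublePrimitive_congr {g g' : ℝ → ℝ} (h : g =ᵐ[unitMeasure] g') {x : ℝ}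
    (hx : x ∈ Icc (0:ℝ) 1) : doublePrimitive g x = doublePrimitive g' x := by
  refine intervalIntegral.integral_congr fun y hy => primitive_congr h ?_
  rw [uIcc_of_le hx.1] at hy
  exact ⟨hy.1, hy.2.trans hx.2⟩

lemma intervalIntegrable_of_subinterval {g : ℝ → ℝ} (hg : IntervalIntegrable g volume 0 1) {y : ℝ}
    (hy : y ∈ Icc (0:ℝ) 1) : IntervalIntegrable g volume 0 y :=
  hg.mono_set (by rw [uIcc_of_le hy.1, uIcc_of_le zero_le_one]; exact Icc_subset_Icc_right hy.2)

lemma primitive_intervalIntegrable {g : ℝ → ℝ} (hg : IntervalIntegrable g volume 0 1) {x : ℝ}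
    (hx : x ∈ Icc (0:ℝ) 1) :
    IntervalIntegrable (fun y => ∫ t in (0:ℝ)..y, g t) volume 0 x := by
  have h := intervalIntegrable_of_subinterval hg hx
  refine ContinuousOn.intervalIntegrable ?_
  refine intervalIntegral.continuousOn_primitive_interval ?_
  rw [uIcc_of_le hx.1, integrableOn_Icc_iff_integrableOn_Ioc]
  exact (intervalIntegrable_iff_integrableOn_Ioc_of_le hx.1).1 h

lemma InAdm.eq_doublePrimitive {N : ℕ} {f : ℕ → ℝ} {u g : ℝ → ℝ} (h : InAdm N f u g) {x : ℝ}
    (hx : x ∈ Icc (0:ℝ) 1) : u x = doublePrimitive g x := by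
  obtain ⟨hu, hg, -, hd, h0, -, hd0, -⟩ := h
  have hder : ∀ y ∈ Ioo 0 x, HasDerivAt u (∫ t in (0:ℝ)..y, g t) y := by
    intro y hy
    have hy' : y ∈ Ioo (0:ℝ) 1 := ⟨hy.1, hy.2.trans_le hx.2⟩
    have h1 := ((hu.differentiableOn one_ne_zero) y (Ioo_subset_Icc_self hy')).hasDerivWithinAt
    rw [hd y (Ioo_subset_Icc_self hy'), hd0, zero_add] at h1
    exact h1.hasDerivAt (Icc_mem_nhds hy'.1 hy'.2)
  have := intervalIntegral.integral_eq_sub_of_hasDerivAt_of_le hx.1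
    (hu.continuousOn.mono (Icc_subset_Icc_right hx.2)) hder (primitive_intervalIntegrable hg hx)
  rw [doublePrimitive, this, h0, sub_zero]

lemma InAdm.integral_eq_zero {N : ℕ} {f : ℕ → ℝ} {u g : ℝ → ℝ} (h : InAdm N f u g) :
    ∫ t in (0:ℝ)..1, g t = 0 := by
  obtain ⟨-, -, -, hd, -, -, hd0, hd1, -⟩ := h
  simpa [hd0, hd1] using (hd 1 (right_mem_Icc.2 zero_le_one)).symm

lemma InAdm.memLp {N : ℕ} {f : ℕ → ℝ} {u g : ℝ → ℝ} (h : InAdm N f u g) :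
    MemLp g 2 unitMeasure := by
  obtain ⟨-, hg, hg2, -⟩ := h
  rw [intervalIntegrable_iff_integrableOn_Ioc_of_le zero_le_one] at hg hg2
  exact (memLp_two_iff_integrable_sq hg.aestronglyMeasurable).2 hg2

lemma node_mem_Icc {N j : ℕ} (hj : j ≤ N) : (j : ℝ) / N ∈ Icc (0:ℝ) 1 :=
  ⟨by positivity, div_le_one_of_le₀ (by exact_mod_cast hj) (by positivity)⟩

lemma inAdm_doublePrimitive {N : ℕ} (hN : 0 < N) {f : ℕ → ℝ} (hfN : f N = 0) {g : ℝ → ℝ}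
    (hg : Integrable g) (hg2 : MemLp g 2 unitMeasure) (h1 : ∫ t in (0:ℝ)..1, g t = 0)
    (hf : ∀ j ≤ N, doublePrimitive g ((j : ℝ) / N) = f j) :
    InAdm N f (doublePrimitive g) g := by
  have hcont : Continuous fun y => ∫ t in (0:ℝ)..y, g t := hg.continuous_primitive 0
  have hder : ∀ x, HasDerivAt (doublePrimitive g) (∫ t in (0:ℝ)..x, g t) x := fun x =>
    hcont.integral_hasStrictDerivAt 0 x |>.hasDerivAt
  have hdw : ∀ x ∈ Icc (0:ℝ) 1,
      derivWithin (doublePrimitive g) (Icc 0 1) x = ∫ t in (0:ℝ)..x, g t := fun x hx =>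
    (hder x).hasDerivWithinAt.derivWithin (uniqueDiffOn_Icc zero_lt_one x hx)
  have hC : ContDiff ℝ 1 (doublePrimitive g) := by
    rw [contDiff_one_iff_deriv]
    refine ⟨fun x => (hder x).differentiableAt, ?_⟩
    rwa [funext fun x => (hder x).deriv]
  have hd0 : derivWithin (doublePrimitive g) (Icc 0 1) 0 = 0 := by
    rw [hdw 0 (by simp), intervalIntegral.integral_same]
  refine ⟨hC.contDiffOn, hg.intervalIntegrable, ?_, ?_, ?_, ?_, hd0, ?_, hf⟩
  · rw [intervalIntegrable_iff_integrableOn_Ioc_of_le zero_le_one]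
    exact hg2.integrable_sq
  · intro x hx
    rw [hd0, hdw x hx, zero_add]
  · simp [doublePrimitive]
  · have := hf N le_rfl
    rwa [div_self (by positivity), hfN] at this
  · rw [hdw 1 (by simp), h1]

lemma exists_inAdm {N : ℕ} (hN : 0 < N) {f : ℕ → ℝ} (hf0 : f 0 = 0) (hfN : f N = 0) :
    ∃ u g, InAdm N f u g := by
  have hN' : (N : ℝ) ≠ 0 := by positivity
  let node : ℕ → ℝ := fun j => (j : ℝ) / N
  let w : ℝ → ℝ := fun x => x ^ 2 * (1 - x) ^ 2
  let L := Lagrange.interpolate (Finset.range (N + 1)) node fun j => f j / w (node j)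
  let p : Polynomial ℝ := Polynomial.X ^ 2 * (1 - Polynomial.X) ^ 2 * L
  have hp : ContDiff ℝ 1 fun x => p.eval x := by
    simpa using p.contDiff_aeval (𝕜 := ℝ) (R := ℝ) 1
  have hdw : ∀ x ∈ Icc (0:ℝ) 1,
      derivWithin (fun x => p.eval x) (Icc 0 1) x = p.derivative.eval x := fun x hx =>
    (p.hasDerivAt x).hasDerivWithinAt.derivWithin (uniqueDiffOn_Icc zero_lt_one x hx)
  have hd0 : derivWithin (fun x => p.eval x) (Icc 0 1) 0 = 0 := by
    rw [hdw 0 (by simp)]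
    simp [p, Polynomial.derivative_mul, Polynomial.derivative_pow]
  have hd1 : derivWithin (fun x => p.eval x) (Icc 0 1) 1 = 0 := by
    rw [hdw 1 (by simp)]
    simp [p, Polynomial.derivative_mul, Polynomial.derivative_pow]
  have hcont : Continuous fun x => p.derivative.derivative.eval x := Polynomial.continuous _
  refine ⟨fun x => p.eval x, fun x => p.derivative.derivative.eval x, hp.contDiffOn,
    hcont.intervalIntegrable _ _, (hcont.pow 2).intervalIntegrable _ _, ?_, by simp [p],
    by simp [p], hd0, hd1, ?_⟩
  · intro x hx
    rw [hd0, zero_add, hdw x hx, intervalIntegral.integral_eq_sub_of_hasDerivAt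
      (fun y _ => p.derivative.hasDerivAt y) (hcont.intervalIntegrable _ _), ← hdw 0 (by simp),
      hd0, sub_zero]
  · intro j hj
    have hinj : Set.InjOn node (Finset.range (N + 1)) := by
      intro a _ b _ hab
      exact_mod_cast (div_left_inj' hN').1 hab
    have hL : L.eval (node j) = f j / w (node j) :=
      Lagrange.eval_interpolate_at_node _ hinj (Finset.mem_range.2 (by omega))
    have hpe : p.eval (node j) = w (node j) * L.eval (node j) := by simp [p, w]
    change p.eval (node j) = f j
    rw [hpe, hL]
    rcases Nat.eq_zero_or_pos j with rfl | hj0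
    · simp [w, node, hf0]
    rcases hj.eq_or_lt with rfl | hjN
    · simp [w, node, hN', hfN]
    have h0 : node j ≠ 0 := by
      have : (0:ℝ) < j := by exact_mod_cast hj0
      positivity
    have h1 : 1 - node j ≠ 0 := by
      have : node j < 1 := (div_lt_one (by positivity)).2 (by exact_mod_cast hjN)
      linarith
    have hw : w (node j) ≠ 0 := by positivity
    field_simp

lemma Lp.intervalIntegrable_unit (G : Lp ℝ 2 unitMeasure) : IntervalIntegrable G volume 0 1 :=
  (intervalIntegrable_iff_integrableOn_Ioc_of_le zero_le_one).2
    ((Lp.memLp G).integrable one_le_two)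

lemma norm_primitive_le (G : Lp ℝ 2 unitMeasure) {y : ℝ} (hy : y ∈ Icc (0:ℝ) 1) :
    ‖∫ t in (0:ℝ)..y, G t‖ ≤ ‖G‖ := by
  have hI : Integrable G unitMeasure := (Lp.memLp G).integrable one_le_two
  have h1 : ‖∫ t in (0:ℝ)..y, G t‖ ≤ ∫ t, ‖G t‖ ∂unitMeasure := by
    rw [intervalIntegral.integral_of_le hy.1]
    refine (norm_integral_le_integral_norm _).trans ?_
    exact setIntegral_mono_set hI.norm (Filter.Eventually.of_forall fun _ => norm_nonneg _)
      (Ioc_subset_Ioc_right hy.2).eventuallyLE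
  refine h1.trans ?_
  rw [Lp.norm_def, integral_norm_eq_lintegral_enorm hI.aestronglyMeasurable,
    ← eLpNorm_one_eq_lintegral_enorm]
  refine ENNReal.toReal_mono (Lp.eLpNorm_ne_top G) ?_
  refine (eLpNorm_le_eLpNorm_mul_rpow_measure_univ one_le_two hI.aestronglyMeasurable).trans ?_
  simp

/-- Evaluation of the primitive at a point of the unit interval, as a functional on `L²(0,1)`. -/
noncomputable def primitiveCLM (y : Icc (0:ℝ) 1) : Lp ℝ 2 unitMeasure →L[ℝ] ℝ :=
  LinearMap.mkContinuous
    { toFun := fun G => ∫ t in (0:ℝ)..y, G t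
      map_add' := fun G H => by
        rw [primitive_congr (Lp.coeFn_add G H) y.2]
        exact intervalIntegral.integral_add
          (intervalIntegrable_of_subinterval (Lp.intervalIntegrable_unit G) y.2)
          (intervalIntegrable_of_subinterval (Lp.intervalIntegrable_unit H) y.2)
      map_smul' := fun c G => by
        rw [primitive_congr (Lp.coeFn_smul c G) y.2]
        exact intervalIntegral.integral_smul c _ }
    1 fun G => by simpa using norm_primitive_le G y.2

/-- Evaluation of the twofold primitive at a point of the unit interval, as a functional on
`L²(0,1)`. -/
noncomputable def doublePrimitiveCLM (x : Icc (0:ℝ) 1) : Lp ℝ 2 unitMeasure →L[ℝ] ℝ :=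
  LinearMap.mkContinuous
    { toFun := fun G => doublePrimitive G x
      map_add' := fun G H => by
        rw [doublePrimitive, doublePrimitive, doublePrimitive, ← intervalIntegral.integral_add
          (primitive_intervalIntegrable (Lp.intervalIntegrable_unit G) x.2)
          (primitive_intervalIntegrable (Lp.intervalIntegrable_unit H) x.2)]
        refine intervalIntegral.integral_congr fun y hy => ?_
        rw [uIcc_of_le x.2.1] at hy
        exact map_add (primitiveCLM ⟨y, hy.1, hy.2.trans x.2.2⟩) G H
      map_smul' := fun c G => by
        rw [doublePrimitive, doublePrimitive, ← intervalIntegral.integral_smul]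
        refine intervalIntegral.integral_congr fun y hy => ?_
        rw [uIcc_of_le x.2.1] at hy
        exact map_smul (primitiveCLM ⟨y, hy.1, hy.2.trans x.2.2⟩) c G }
    1 fun G => by
      have h : ∀ y ∈ uIoc (0:ℝ) x, ‖∫ t in (0:ℝ)..y, G t‖ ≤ ‖G‖ := fun y hy => by
        rw [uIoc_of_le x.2.1] at hy
        exact norm_primitive_le G ⟨hy.1.le, hy.2.trans x.2.2⟩
      have h' := intervalIntegral.norm_integral_le_of_norm_le_const h
      rw [sub_zero, abs_of_nonneg x.2.1] at h'
      rw [one_mul]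
      exact h'.trans (mul_le_of_le_one_right (norm_nonneg _) x.2.2)

/-- The second derivatives in `L²(0,1)` of the functions admissible for zero data. -/
noncomputable def homogeneousSubmodule (N : ℕ) : Submodule ℝ (Lp ℝ 2 unitMeasure) :=
  (primitiveCLM ⟨1, by simp⟩).ker ⊓
    ⨅ j : Fin (N + 1), (doublePrimitiveCLM ⟨_, node_mem_Icc (Nat.le_of_lt_succ j.2)⟩).ker

lemma mem_homogeneousSubmodule {N : ℕ} {G : Lp ℝ 2 unitMeasure} :
    G ∈ homogeneousSubmodule N ↔
      primitiveCLM ⟨1, by simp⟩ G = 0 ∧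
        ∀ j (hj : j ≤ N), doublePrimitiveCLM ⟨_, node_mem_Icc hj⟩ G = 0 := by
  simp only [homogeneousSubmodule, Submodule.mem_inf, Submodule.mem_iInf, LinearMap.mem_ker]
  exact and_congr Iff.rfl ⟨fun h j hj => h ⟨j, Nat.lt_succ_of_le hj⟩, fun h j => h j (Nat.le_of_lt_succ j.2)⟩

lemma isClosed_homogeneousSubmodule (N : ℕ) :
    IsClosed (homogeneousSubmodule N : Set (Lp ℝ 2 unitMeasure)) := by
  rw [homogeneousSubmodule, Submodule.coe_inf, Submodule.coe_iInf]
  exact (ContinuousLinearMap.isClosed_ker _).inter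
    (isClosed_iInter fun _ => ContinuousLinearMap.isClosed_ker _)

lemma InAdm.primitiveCLM_toLp {N : ℕ} {f : ℕ → ℝ} {u g : ℝ → ℝ} (h : InAdm N f u g) :
    primitiveCLM ⟨1, by simp⟩ (h.memLp.toLp g) = 0 :=
  (primitive_congr h.memLp.coeFn_toLp (by simp)).trans h.integral_eq_zero

lemma InAdm.doublePrimitiveCLM_toLp {N : ℕ} {f : ℕ → ℝ} {u g : ℝ → ℝ} (h : InAdm N f u g) {j : ℕ}
    (hj : j ≤ N) : doublePrimitiveCLM ⟨_, node_mem_Icc hj⟩ (h.memLp.toLp g) = f j := by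
  refine (doublePrimitive_congr h.memLp.coeFn_toLp (node_mem_Icc hj)).trans ?_
  rw [← h.eq_doublePrimitive (node_mem_Icc hj)]
  exact h.2.2.2.2.2.2.2.2 j hj

lemma InAdm.energy_eq {N : ℕ} {f : ℕ → ℝ} {u g : ℝ → ℝ} (h : InAdm N f u g) :
    energy g = ‖h.memLp.toLp g‖ ^ 2 := by
  rw [energy, intervalIntegral.integral_of_le zero_le_one, ← real_inner_self_eq_norm_sq,
    L2.inner_def]
  refine integral_congr_ae ?_
  filter_upwards [h.memLp.coeFn_toLp] with x hx
  rw [hx, real_inner_self_eq_norm_sq, Real.norm_eq_abs, sq_abs]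

lemma InAdm.sub_mem {N : ℕ} {f : ℕ → ℝ} {u g v w : ℝ → ℝ} (h : InAdm N f u g)
    (h' : InAdm N f v w) : h.memLp.toLp g - h'.memLp.toLp w ∈ homogeneousSubmodule N := by
  rw [mem_homogeneousSubmodule]
  refine ⟨?_, fun j hj => ?_⟩
  · rw [map_sub, h.primitiveCLM_toLp, h'.primitiveCLM_toLp, sub_zero]
  · rw [map_sub, h.doublePrimitiveCLM_toLp hj, h'.doublePrimitiveCLM_toLp hj, sub_self]

lemma exists_inAdm_of_lp {N : ℕ} (hN : 0 < N) {f : ℕ → ℝ} (hfN : f N = 0)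
    (G : Lp ℝ 2 unitMeasure) (h1 : primitiveCLM ⟨1, by simp⟩ G = 0)
    (hf : ∀ j (hj : j ≤ N), doublePrimitiveCLM ⟨_, node_mem_Icc hj⟩ G = f j) :
    ∃ (u g : ℝ → ℝ) (h : InAdm N f u g), h.memLp.toLp g = G := by
  have hae : (Ioc (0:ℝ) 1).indicator G =ᵐ[unitMeasure] G :=
    indicator_ae_eq_restrict measurableSet_Ioc
  have hint : Integrable ((Ioc (0:ℝ) 1).indicator G) :=
    (integrable_indicator_iff measurableSet_Ioc).2 ((Lp.memLp G).integrable one_le_two)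
  have hadm : InAdm N f (doublePrimitive ((Ioc (0:ℝ) 1).indicator G))
      ((Ioc (0:ℝ) 1).indicator G) :=
    inAdm_doublePrimitive hN hfN hint ((memLp_congr_ae hae).2 (Lp.memLp G))
      ((primitive_congr hae (by simp)).trans h1)
      fun j hj => (doublePrimitive_congr hae (node_mem_Icc hj)).trans (hf j hj)
  exact ⟨_, _, hadm, Lp.ext (hadm.memLp.coeFn_toLp.trans hae)⟩

lemma exists_inAdm_orthogonal {N : ℕ} (hN : 0 < N) {f : ℕ → ℝ} (hf0 : f 0 = 0) (hfN : f N = 0) :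
    ∃ (s gs : ℝ → ℝ) (h : InAdm N f s gs), h.memLp.toLp gs ∈ (homogeneousSubmodule N)ᗮ := by
  obtain ⟨u, g, h⟩ := exists_inAdm hN hf0 hfN
  have : CompleteSpace (homogeneousSubmodule N) :=
    (isClosed_homogeneousSubmodule N).completeSpace_coe
  set P := (homogeneousSubmodule N).starProjection (h.memLp.toLp g)
  have hPmem := mem_homogeneousSubmodule.1
    ((homogeneousSubmodule N).starProjection_apply_mem (h.memLp.toLp g))
  obtain ⟨s, gs, hs, hG⟩ := exists_inAdm_of_lp hN hfN (h.memLp.toLp g - P)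
    (by rw [map_sub, h.primitiveCLM_toLp, hPmem.1, sub_zero])
    fun j hj => by rw [map_sub, h.doublePrimitiveCLM_toLp hj, hPmem.2 j hj, sub_zero]
  refine ⟨s, gs, hs, ?_⟩
  rw [hG]
  exact (homogeneousSubmodule N).sub_starProjection_mem_orthogonal _

/-- The functional `I(u) = ∫₀¹ |u''|²` attains its minimum over the admissible class `A`,
and the minimizer is unique: there is exactly one `s ∈ A` with `I(s) ≤ I(u)` for all
`u ∈ A`. -/
theorem spline_minimizer_exists_unique
    (N : ℕ) (hN : 2 ≤ N) (f : ℕ → ℝ) (hf0 : f 0 = 0) (hfN : f N = 0) :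
    ∃ s gs : ℝ → ℝ, InAdm N f s gs ∧
      (∀ u g : ℝ → ℝ, InAdm N f u g → energy gs ≤ energy g) ∧
      (∀ u g : ℝ → ℝ, InAdm N f u g →
        (∀ v w : ℝ → ℝ, InAdm N f v w → energy g ≤ energy w) →
        Set.EqOn u s (Set.Icc 0 1)) := by
  obtain ⟨s, gs, hs, horth⟩ := exists_inAdm_orthogonal (by omega) hf0 hfN
  have pythagoras : ∀ u g (h : InAdm N f u g),
      energy g = energy gs + ‖h.memLp.toLp g - hs.memLp.toLp gs‖ ^ 2 := by
    intro u g h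
    have h0 := (Submodule.mem_orthogonal' _ _).1 horth _ (h.sub_mem hs)
    have := norm_add_sq_real (hs.memLp.toLp gs) (h.memLp.toLp g - hs.memLp.toLp gs)
    rw [add_sub_cancel, h0] at this
    rw [h.energy_eq, hs.energy_eq, this]
    ring
  refine ⟨s, gs, hs, fun u g h => ?_, fun u g h hmin x hx => ?_⟩
  · rw [pythagoras u g h]
    exact le_add_of_nonneg_right (sq_nonneg _)
  · have hle := hmin s gs hs
    rw [pythagoras u g h] at hle
    have hzero : ‖h.memLp.toLp g - hs.memLp.toLp gs‖ = 0 :=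
      pow_eq_zero_iff two_ne_zero |>.1 (le_antisymm (by linarith) (sq_nonneg _))
    have heq := sub_eq_zero.1 (norm_eq_zero.1 hzero)
    rw [h.eq_doublePrimitive hx, hs.eq_doublePrimitive hx]
    exact doublePrimitive_congr ((MemLp.toLp_eq_toLp_iff _ _).1 heq) hx
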